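/- arXiv:2311.09083 — 7 statements merged into one kernel-verified Lean document; each statement's English description precedes it below -/
import Mathlib

section
/- Let n_A ≥ 1 be a natural number. The function σ(v) = (n_A/(n_A+1))·v satisfies, for every v ∈ [0,1], the equilibrium integral equation σ(v)^{n_A+1} − v·σ(v)^{n_A} + ∫₀^v σ(t)^{n_A} dt = 0. -/
open MeasureTheory intervalIntegral

/-- For `n_A ≥ 1`, the function `σ(v) = (n_A/(n_A+1))·v` satisfies, for every
`v ∈ [0,1]`, the equilibrium integral equation
`σ(v)^{n_A+1} − v·σ(v)^{n_A} + ∫₀^v σ(t)^{n_A} dt = 0`. -/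
theorem stmt0 (nA : ℕ) (hnA : 1 ≤ nA) (σ : ℝ → ℝ)
    (hσ : ∀ v : ℝ, σ v = ((nA : ℝ) / ((nA : ℝ) + 1)) * v) :
    ∀ v ∈ Set.Icc (0 : ℝ) 1,
      σ v ^ (nA + 1) - v * σ v ^ nA + (∫ t in (0 : ℝ)..v, σ t ^ nA) = 0 := by
  intro v _
  have h1 : (nA : ℝ) + 1 ≠ 0 := by positivity
  have hc : (nA : ℝ) / ((nA : ℝ) + 1) = 1 - 1 / ((nA : ℝ) + 1) := by
    field_simp
    ring
  simp only [hσ, mul_pow]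
  rw [intervalIntegral.integral_const_mul, integral_pow, zero_pow (Nat.succ_ne_zero nA)]
  generalize (nA : ℝ) / ((nA : ℝ) + 1) = c at *
  have h2 : c ^ (nA + 1) = c ^ nA * (1 - 1 / ((nA : ℝ) + 1)) := by
    rw [pow_succ, ← hc]
  rw [h2]
  ring
end

section
/- Let n_A ≥ 1 be a natural number. Suppose σ : ℝ → ℝ is continuous on [0,1], differentiable on (0,1) with σ'(v) > 0 and σ(v) > 0 for all v ∈ (0,1), σ(0) = 0, and satisfies σ(v)^{n_A+1} − v·σ(v)^{n_A} + ∫₀^v σ(t)^{n_A} dt = 0 for all v ∈ [0,1]. Then σ(v) = (n_A/(n_A+1))·v for all v ∈ [0,1]. -/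
open MeasureTheory intervalIntegral Set

/-- For `n_A ≥ 1`, if `σ` is continuous on `[0,1]`, differentiable on `(0,1)`
with strictly positive derivative and `σ(v) > 0` on `(0,1)`, `σ(0) = 0`, and satisfies
`σ(v)^{n_A+1} − v·σ(v)^{n_A} + ∫₀^v σ(t)^{n_A} dt = 0` for all `v ∈ [0,1]`,
then `σ(v) = (n_A/(n_A+1))·v` for all `v ∈ [0,1]`. -/
theorem stmt1 (nA : ℕ) (hnA : 1 ≤ nA) (σ σ' : ℝ → ℝ)
    (hcont : ContinuousOn σ (Set.Icc 0 1))
    (hderiv : ∀ v ∈ Set.Ioo (0 : ℝ) 1, HasDerivAt σ (σ' v) v)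
    (hderiv_pos : ∀ v ∈ Set.Ioo (0 : ℝ) 1, 0 < σ' v)
    (hσ_pos : ∀ v ∈ Set.Ioo (0 : ℝ) 1, 0 < σ v)
    (hσ0 : σ 0 = 0)
    (heq : ∀ v ∈ Set.Icc (0 : ℝ) 1,
      σ v ^ (nA + 1) - v * σ v ^ nA + (∫ t in (0 : ℝ)..v, σ t ^ nA) = 0) :
    ∀ v ∈ Set.Icc (0 : ℝ) 1, σ v = ((nA : ℝ) / ((nA : ℝ) + 1)) * v := by
  have hint : ∀ v ∈ Set.Ioo (0 : ℝ) 1, σ v = ((nA : ℝ) / ((nA : ℝ) + 1)) * v := by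
    intro v hv
    have hpow : ContinuousOn (fun t => σ t ^ nA) (Set.Icc 0 1) := hcont.pow nA
    have hnhds : Set.Ioo (0 : ℝ) 1 ∈ nhds v := isOpen_Ioo.mem_nhds hv
    have hI : HasDerivAt (fun u => ∫ t in (0 : ℝ)..u, σ t ^ nA) (σ v ^ nA) v := by
      apply intervalIntegral.integral_hasDerivAt_right
      · apply ContinuousOn.intervalIntegrable
        rw [Set.uIcc_of_le hv.1.le]
        exact hpow.mono (Set.Icc_subset_Icc le_rfl hv.2.le)
      · exact (hpow.mono Set.Ioo_subset_Icc_self).stronglyMeasurableAtFilter isOpen_Ioo v hv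
      · exact ((hderiv v hv).continuousAt.pow nA)
    have hs := hderiv v hv
    have hF := ((hs.pow (nA + 1)).sub ((hasDerivAt_id v).mul (hs.pow nA))).add hI
    have h0 : HasDerivAt (fun _ : ℝ => (0 : ℝ)) 0 v := hasDerivAt_const v 0
    have hF0 := h0.congr_of_eventuallyEq (f₁ := _) (by
      filter_upwards [hnhds] with u hu
      exact heq u (Set.Ioo_subset_Icc_self hu))
    have hD := hF.unique hF0
    obtain ⟨m, rfl⟩ : ∃ m, nA = m + 1 := ⟨nA - 1, by omega⟩
    have hp := hσ_pos v hv
    have hd := hderiv_pos v hv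
    simp only [id, Nat.add_sub_cancel] at hD
    push_cast at hD ⊢
    have hz : (σ v ^ m * σ' v) * (((m : ℝ) + 1 + 1) * σ v - ((m : ℝ) + 1) * v) = 0 := by
      simp only [Pi.pow_apply] at hD
      linear_combination hD
    have hz2 := (mul_eq_zero.mp hz).resolve_left (by positivity)
    field_simp
    linarith
  have hE : Set.EqOn σ (fun v => ((nA : ℝ) / ((nA : ℝ) + 1)) * v) (Set.Icc 0 1) := by
    apply Set.EqOn.of_subset_closure (s := Set.Ioo (0 : ℝ) 1) hint hcont (by fun_prop)
      Set.Ioo_subset_Icc_self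
    rw [closure_Ioo (by norm_num)]
  exact hE
end

section
/- Let n ≥ 2 and n_A ≥ 1 be natural numbers. Suppose σ : ℝ → ℝ is continuous on [0,1], differentiable on (0,1), with σ(v) > 0 for all v ∈ (0,1), and satisfies v^{n−1}·σ(v)^{n_A+1} − v^n·σ(v)^{n_A} + ∫₀^v t^{n−1}·σ(t)^{n_A} dt = 0 for all v ∈ [0,1]. Then for every v ∈ (0,1): ((n_A+1)·v·σ(v) − n_A·v²)·σ'(v) = (n−1)·σ(v)·(v − σ(v)). -/
open MeasureTheory intervalIntegral

/-- For `n ≥ 2`, `n_A ≥ 1`, if `σ` is continuous on `[0,1]`, differentiable on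
`(0,1)`, positive on `(0,1)`, and satisfies
`v^{n−1}·σ(v)^{n_A+1} − v^n·σ(v)^{n_A} + ∫₀^v t^{n−1}·σ(t)^{n_A} dt = 0` on `[0,1]`, then for
every `v ∈ (0,1)`: `((n_A+1)·v·σ(v) − n_A·v²)·σ'(v) = (n−1)·σ(v)·(v − σ(v))`. -/
theorem stmt3 (n nA : ℕ) (hn : 2 ≤ n) (hnA : 1 ≤ nA) (σ σ' : ℝ → ℝ)
    (hcont : ContinuousOn σ (Set.Icc 0 1))
    (hderiv : ∀ v ∈ Set.Ioo (0 : ℝ) 1, HasDerivAt σ (σ' v) v)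
    (hσ_pos : ∀ v ∈ Set.Ioo (0 : ℝ) 1, 0 < σ v)
    (heq : ∀ v ∈ Set.Icc (0 : ℝ) 1,
      v ^ (n - 1) * σ v ^ (nA + 1) - v ^ n * σ v ^ nA
        + (∫ t in (0 : ℝ)..v, t ^ (n - 1) * σ t ^ nA) = 0) :
    ∀ v ∈ Set.Ioo (0 : ℝ) 1,
      (((nA : ℝ) + 1) * v * σ v - (nA : ℝ) * v ^ 2) * σ' v
        = ((n : ℝ) - 1) * σ v * (v - σ v) := by
  obtain ⟨m, rfl⟩ := Nat.exists_eq_add_of_le' hn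
  obtain ⟨a, rfl⟩ := Nat.exists_eq_add_of_le' hnA
  intro v hv
  have hs := hσ_pos v hv
  have hd := hderiv v hv
  have e1 : m + 2 - 1 = m + 1 := rfl
  simp only [e1] at heq
  have hcf : ContinuousOn (fun t : ℝ => t ^ (m + 1) * σ t ^ (a + 1)) (Set.Icc 0 1) := by
    fun_prop
  have hnhds : Set.Icc (0 : ℝ) 1 ∈ nhds v := Icc_mem_nhds hv.1 hv.2
  have hint : HasDerivAt (fun u => ∫ t in (0 : ℝ)..u, t ^ (m + 1) * σ t ^ (a + 1))
      (v ^ (m + 1) * σ v ^ (a + 1)) v := by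
    refine intervalIntegral.integral_hasDerivAt_right
      (f := fun t : ℝ => t ^ (m + 1) * σ t ^ (a + 1)) ?_ ?_ (hcf.continuousAt hnhds)
    · apply ContinuousOn.intervalIntegrable
      rw [Set.uIcc_of_le hv.1.le]
      exact hcf.mono (Set.Icc_subset_Icc_right hv.2.le)
    · exact ⟨Set.Icc 0 1, hnhds, hcf.aestronglyMeasurable measurableSet_Icc⟩
  have h1 := (((hasDerivAt_pow (m + 1) v).fun_mul (hd.fun_pow (a + 1 + 1))).fun_sub
    ((hasDerivAt_pow (m + 2) v).fun_mul (hd.fun_pow (a + 1)))).fun_add hint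
  have h0 : HasDerivAt (fun _ : ℝ => (0 : ℝ)) 0 v := hasDerivAt_const v 0
  have h2 := h1.unique (h0.congr_of_eventuallyEq
    (Filter.eventually_of_mem hnhds (fun u hu => heq u hu)))
  have hne : v ^ m * σ v ^ a ≠ 0 :=
    mul_ne_zero (pow_ne_zero _ hv.1.ne') (pow_ne_zero _ hs.ne')
  apply mul_left_cancel₀ hne
  simp only [Nat.add_sub_cancel, show m + 2 - 1 = m + 1 from rfl] at h2
  push_cast at h2 ⊢
  linear_combination h2
end

section
/- Let n ≥ 2 and n_A ≥ 1 be natural numbers. Suppose σ : ℝ → ℝ is continuous on [0,1], differentiable on (0,1), with σ(v) > 0 for all v ∈ (0,1), satisfies v^{n−1}·σ(v)^{n_A+1} − v^n·σ(v)^{n_A} + ∫₀^v t^{n−1}·σ(t)^{n_A} dt = 0 for all v ∈ [0,1], and moreover (n_A+1)·σ(v) ≠ n_A·v for all v ∈ (0,1). Then for every v ∈ (0,1): σ'(v) = (n−1)·σ(v)·(v − σ(v)) / (v·((n_A+1)·σ(v) − n_A·v)). -/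
open MeasureTheory intervalIntegral

/-- Under the hypotheses of Statement 3, and assuming moreover
`(n_A+1)·σ(v) ≠ n_A·v` on `(0,1)`, for every `v ∈ (0,1)`:
`σ'(v) = (n−1)·σ(v)·(v − σ(v)) / (v·((n_A+1)·σ(v) − n_A·v))`. -/
theorem stmt4 (n nA : ℕ) (hn : 2 ≤ n) (hnA : 1 ≤ nA) (σ σ' : ℝ → ℝ)
    (hcont : ContinuousOn σ (Set.Icc 0 1))
    (hderiv : ∀ v ∈ Set.Ioo (0 : ℝ) 1, HasDerivAt σ (σ' v) v)
    (hσ_pos : ∀ v ∈ Set.Ioo (0 : ℝ) 1, 0 < σ v)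
    (heq : ∀ v ∈ Set.Icc (0 : ℝ) 1,
      v ^ (n - 1) * σ v ^ (nA + 1) - v ^ n * σ v ^ nA
        + (∫ t in (0 : ℝ)..v, t ^ (n - 1) * σ t ^ nA) = 0)
    (hne : ∀ v ∈ Set.Ioo (0 : ℝ) 1, ((nA : ℝ) + 1) * σ v ≠ (nA : ℝ) * v) :
    ∀ v ∈ Set.Ioo (0 : ℝ) 1,
      σ' v = ((n : ℝ) - 1) * σ v * (v - σ v)
        / (v * (((nA : ℝ) + 1) * σ v - (nA : ℝ) * v)) := by
  obtain ⟨k, rfl⟩ := Nat.exists_eq_add_of_le' hn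
  obtain ⟨m, rfl⟩ := Nat.exists_eq_add_of_le' hnA
  intro v hv
  have hv0 : 0 < v := hv.1
  have hs := hσ_pos v hv
  have hne' := hne v hv
  have hd := hderiv v hv
  have e1 : k + 2 - 1 = k + 1 := rfl
  rw [e1] at heq
  have hc : ContinuousOn (fun t : ℝ => t ^ (k + 1) * σ t ^ (m + 1)) (Set.Icc 0 1) :=
    (continuousOn_id.pow _).mul (hcont.pow _)
  have hint : IntervalIntegrable (fun t : ℝ => t ^ (k + 1) * σ t ^ (m + 1)) volume 0 v := by
    apply ContinuousOn.intervalIntegrable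
    rw [Set.uIcc_of_le hv0.le]
    exact hc.mono (Set.Icc_subset_Icc le_rfl hv.2.le)
  have hI : HasDerivAt (fun u : ℝ => ∫ t in (0 : ℝ)..u, t ^ (k + 1) * σ t ^ (m + 1))
      (v ^ (k + 1) * σ v ^ (m + 1)) v := by
    apply intervalIntegral.integral_hasDerivAt_right hint
    · exact (hc.mono Set.Ioo_subset_Icc_self).stronglyMeasurableAtFilter isOpen_Ioo v hv
    · exact hc.continuousAt (Icc_mem_nhds hv.1 hv.2)
  have hF := (((hasDerivAt_pow (k + 1) v).mul (hd.pow (m + 1 + 1))).sub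
    ((hasDerivAt_pow (k + 2) v).mul (hd.pow (m + 1)))).add hI
  have hZ := hF.congr_of_eventuallyEq (f₁ := fun _ => (0 : ℝ)) (by
    filter_upwards [Ioo_mem_nhds hv.1 hv.2] with u hu
    exact (heq u (Set.Ioo_subset_Icc_self hu)).symm)
  have h0 := hZ.unique (hasDerivAt_const v (0 : ℝ))
  simp only [Pi.pow_apply, Nat.add_sub_cancel, e1] at h0
  push_cast at h0 hne' ⊢
  have hD : v * (((m : ℝ) + 1 + 1) * σ v - ((m : ℝ) + 1) * v) ≠ 0 :=
    mul_ne_zero hv0.ne' (sub_ne_zero.mpr hne')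
  rw [eq_div_iff hD]
  have hp : v ^ k * σ v ^ m ≠ 0 := by positivity
  apply mul_left_cancel₀ hp
  linear_combination h0
end

section
/- Let n ≥ 2 and n_A ≥ 1 be natural numbers. Suppose σ : ℝ → ℝ is continuous on [0,1], differentiable on (0,1) with σ'(v) > 0 and σ(v) > 0 for all v ∈ (0,1), σ(0) = 0, and satisfies v^{n−1}·σ(v)^{n_A+1} − v^n·σ(v)^{n_A} + ∫₀^v t^{n−1}·σ(t)^{n_A} dt = 0 for all v ∈ [0,1]. Then for every v ∈ [0,1]: (n_A/(n_A+1))·v ≤ σ(v) ≤ v. -/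
open MeasureTheory intervalIntegral

/-- For `n ≥ 2`, `n_A ≥ 1`, if `σ` is continuous on `[0,1]`, differentiable on
`(0,1)` with strictly positive derivative and `σ > 0` on `(0,1)`, `σ(0) = 0`, and satisfies
`v^{n−1}·σ(v)^{n_A+1} − v^n·σ(v)^{n_A} + ∫₀^v t^{n−1}·σ(t)^{n_A} dt = 0` on `[0,1]`, then for
every `v ∈ [0,1]`: `(n_A/(n_A+1))·v ≤ σ(v) ≤ v`. -/
theorem stmt5 (n nA : ℕ) (hn : 2 ≤ n) (hnA : 1 ≤ nA) (σ σ' : ℝ → ℝ)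
    (hcont : ContinuousOn σ (Set.Icc 0 1))
    (hderiv : ∀ v ∈ Set.Ioo (0 : ℝ) 1, HasDerivAt σ (σ' v) v)
    (hderiv_pos : ∀ v ∈ Set.Ioo (0 : ℝ) 1, 0 < σ' v)
    (hσ_pos : ∀ v ∈ Set.Ioo (0 : ℝ) 1, 0 < σ v)
    (hσ0 : σ 0 = 0)
    (heq : ∀ v ∈ Set.Icc (0 : ℝ) 1,
      v ^ (n - 1) * σ v ^ (nA + 1) - v ^ n * σ v ^ nA
        + (∫ t in (0 : ℝ)..v, t ^ (n - 1) * σ t ^ nA) = 0) :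
    ∀ v ∈ Set.Icc (0 : ℝ) 1,
      ((nA : ℝ) / ((nA : ℝ) + 1)) * v ≤ σ v ∧ σ v ≤ v := by
  obtain ⟨m, rfl⟩ : ∃ m, n = m + 2 := ⟨n - 2, by omega⟩
  obtain ⟨k, rfl⟩ : ∃ k, nA = k + 1 := ⟨nA - 1, by omega⟩
  have e1 : m + 2 - 1 = m + 1 := by omega
  rw [e1] at heq
  have key : ∀ v ∈ Set.Ioo (0 : ℝ) 1,
      (((k + 1 : ℕ) : ℝ) / (((k + 1 : ℕ) : ℝ) + 1)) * v ≤ σ v ∧ σ v ≤ v := by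
    intro v hv
    have hv0 := hv.1
    have hs := hσ_pos v hv
    have hd := hderiv_pos v hv
    have hc : ContinuousOn (fun t => t ^ (m + 1) * σ t ^ (k + 1)) (Set.Icc 0 1) :=
      (continuousOn_id.pow _).mul (hcont.pow _)
    have hI : 0 ≤ ∫ t in (0 : ℝ)..v, t ^ (m + 1) * σ t ^ (k + 1) := by
      apply intervalIntegral.integral_nonneg hv0.le
      intro t ht
      rcases ht.1.eq_or_lt with h | h
      · simp [← h]
      · have := hσ_pos t ⟨h, ht.2.trans_lt hv.2⟩
        positivity
    have h0 := heq v ⟨hv.1.le, hv.2.le⟩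
    have hup : σ v ≤ v := by
      by_contra hlt
      push Not at hlt
      have h1 : 0 < v ^ (m + 1) * σ v ^ (k + 1) * (σ v - v) :=
        mul_pos (by positivity) (by linarith)
      have h2 : v ^ (m + 1) * σ v ^ (k + 1 + 1) - v ^ (m + 2) * σ v ^ (k + 1)
        = v ^ (m + 1) * σ v ^ (k + 1) * (σ v - v) := by ring
      linarith
    refine ⟨?_, hup⟩
    have hnh : Set.Icc (0 : ℝ) 1 ∈ nhds v := Icc_mem_nhds hv.1 hv.2
    have hII : IntervalIntegrable (fun t => t ^ (m + 1) * σ t ^ (k + 1)) volume 0 v := by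
      apply ContinuousOn.intervalIntegrable
      rw [Set.uIcc_of_le hv0.le]
      exact hc.mono (Set.Icc_subset_Icc le_rfl hv.2.le)
    have hD := intervalIntegral.integral_hasDerivAt_right hII
      ⟨Set.Icc 0 1, hnh, hc.aestronglyMeasurable measurableSet_Icc⟩ (hc.continuousAt hnh)
    have hσd := hderiv v hv
    have hT := (((hasDerivAt_pow (m + 1) v).mul (hσd.pow (k + 1 + 1))).sub
      ((hasDerivAt_pow (m + 2) v).mul (hσd.pow (k + 1)))).add hD
    have hZ := hT.unique ((hasDerivAt_const v (0 : ℝ)).congr_of_eventuallyEq (by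
      filter_upwards [hnh] with x hx
      exact heq x hx))
    simp only [Nat.add_sub_cancel, Pi.pow_apply, show m + 2 - 1 = m + 1 from rfl] at hZ
    push_cast at hZ ⊢
    have hfac : v ^ m * σ v ^ k * (v * σ' v * (((k : ℝ) + 2) * σ v - (k + 1) * v)
        - (m + 1) * σ v * (v - σ v)) = 0 := by
      linear_combination hZ
    have hz2 := (mul_eq_zero.1 hfac).resolve_left (by positivity)
    have hnn : 0 ≤ ((m : ℝ) + 1) * σ v * (v - σ v) :=
      mul_nonneg (by positivity) (by linarith)
    have h3 : 0 ≤ ((k : ℝ) + 2) * σ v - (k + 1) * v := by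
      by_contra hneg
      push Not at hneg
      have := mul_neg_of_pos_of_neg (mul_pos hv0 hd) hneg
      linarith
    rw [div_mul_eq_mul_div, div_le_iff₀ (by positivity)]
    linarith
  have hcl : closure (Set.Ioo (0 : ℝ) 1) = Set.Icc 0 1 := closure_Ioo (by norm_num)
  intro v hv
  rw [← hcl] at hcont hv
  exact ⟨le_on_closure (fun x hx => (key x hx).1) (by fun_prop) hcont hv,
    le_on_closure (fun x hx => (key x hx).2) hcont (by fun_prop) hv⟩
end

section
/- Let s > 0, Δ > 0, v₀ > 0, and b > 0. Let μ = gaussianReal(−s²Δ/2, s²Δ) be the Gaussian measure on ℝ with mean −s²Δ/2 and variance s²Δ, and set V(x) = v₀·exp(x). Then ∫ (V(x) − b)·1_{V(x) ≤ b} dμ(x) < 0; that is, a slow bidder bidding any b > 0, who wins exactly when the time-Δ value v_Δ = v₀·exp(m_Δ) is at most b, has strictly negative expected profit. -/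
open MeasureTheory ProbabilityTheory Real

/-- For `s, Δ, v₀, b > 0`, with `μ = gaussianReal(−s²Δ/2, s²Δ)` and
`V(x) = v₀·exp(x)`, we have `∫ (V(x) − b)·1_{V(x) ≤ b} dμ(x) < 0`: a slow bidder bidding
`b > 0`, who wins exactly when the time-`Δ` value `v₀·exp(m_Δ)` is at most `b`, has strictly
negative expected profit. -/
theorem stmt7 (s Δ v₀ b : ℝ) (hs : 0 < s) (hΔ : 0 < Δ) (hv₀ : 0 < v₀) (hb : 0 < b) :
    (∫ x, Set.indicator {x : ℝ | v₀ * Real.exp x ≤ b} (fun x => v₀ * Real.exp x - b) x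
        ∂(gaussianReal (-(s ^ 2 * Δ) / 2) ((s ^ 2 * Δ).toNNReal))) < 0 := by
  have hv : (s ^ 2 * Δ).toNNReal ≠ 0 := by
    have : 0 < s ^ 2 * Δ := by positivity
    exact (Real.toNNReal_pos.mpr this).ne'
  set μ := gaussianReal (-(s ^ 2 * Δ) / 2) ((s ^ 2 * Δ).toNNReal) with hμ
  set f : ℝ → ℝ := Set.indicator {x : ℝ | v₀ * Real.exp x ≤ b} (fun x => v₀ * Real.exp x - b)
    with hf
  have hms : MeasurableSet {x : ℝ | v₀ * Real.exp x ≤ b} :=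
    measurableSet_le (by fun_prop) measurable_const
  have hmf : Measurable f := Measurable.indicator (by fun_prop) hms
  have hnonneg : ∀ x, 0 ≤ -f x := by
    intro x
    by_cases hx : v₀ * Real.exp x ≤ b
    · have : f x = v₀ * Real.exp x - b := Set.indicator_of_mem (by exact hx) _
      linarith
    · have : f x = 0 := Set.indicator_of_notMem (by exact hx) _
      linarith
  have hle : ∀ x, -f x ≤ b := by
    intro x
    by_cases hx : v₀ * Real.exp x ≤ b
    · have : f x = v₀ * Real.exp x - b := Set.indicator_of_mem (by exact hx) _
      have : 0 < v₀ * Real.exp x := by positivity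
      linarith
    · have : f x = 0 := Set.indicator_of_notMem (by exact hx) _
      linarith
  have hint : Integrable (fun x => -f x) μ := by
    refine Integrable.of_bound hmf.neg.aestronglyMeasurable b (Filter.Eventually.of_forall ?_)
    intro x
    rw [Real.norm_eq_abs, abs_of_nonneg (hnonneg x)]
    exact hle x
  have hsub : Set.Iio (Real.log (b / v₀)) ⊆ Function.support (fun x => -f x) := by
    intro x hx
    have h1 : Real.exp x < b / v₀ := (Real.lt_log_iff_exp_lt (by positivity)).mp hx
    have h2 : v₀ * Real.exp x < b := by
      rw [lt_div_iff₀ hv₀] at h1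
      linarith
    have : f x = v₀ * Real.exp x - b := Set.indicator_of_mem (by exact h2.le) _
    rw [Function.mem_support]
    intro h
    linarith
  have hpos : 0 < ∫ x, -f x ∂μ := by
    rw [integral_pos_iff_support_of_nonneg hnonneg hint]
    refine lt_of_lt_of_le ?_ (measure_mono hsub)
    rw [pos_iff_ne_zero]
    intro h0
    have := gaussianReal_absolutelyContinuous' (-(s ^ 2 * Δ) / 2) hv h0
    simp at this
  rw [integral_neg] at hpos
  linarith
end

section
/- Let s > 0, Δ > 0, v₀ > 0, and 0 < p < 1. Let μ = gaussianReal(−s²Δ/2, s²Δ), V(x) = v₀·exp(x), and define g(b) = (1−p)·(v₀ − b) + p·∫ (V(x) − b)·1_{V(x) < b} dμ(x) for b ∈ ℝ. Then the set {b ∈ [0, v₀] | g(b) = 0} is nonempty and has a greatest element b*, and b* ∈ (0, v₀). -/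
open MeasureTheory ProbabilityTheory Real

/-- For `s, Δ, v₀ > 0` and `0 < p < 1`, with `μ = gaussianReal(−s²Δ/2, s²Δ)`,
`V(x) = v₀·exp(x)` and `g(b) = (1−p)·(v₀ − b) + p·∫ (V(x) − b)·1_{V(x) < b} dμ(x)`, the set
`{b ∈ [0, v₀] | g b = 0}` is nonempty and has a greatest element `b*`, and `b* ∈ (0, v₀)`. -/
theorem stmt12 (s Δ v₀ p : ℝ) (hs : 0 < s) (hΔ : 0 < Δ) (hv₀ : 0 < v₀)
    (hp0 : 0 < p) (hp1 : p < 1)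
    (g : ℝ → ℝ)
    (hg : ∀ b : ℝ, g b = (1 - p) * (v₀ - b)
        + p * ∫ x, Set.indicator {x : ℝ | v₀ * Real.exp x < b}
            (fun x => v₀ * Real.exp x - b) x
          ∂(gaussianReal (-(s ^ 2 * Δ) / 2) ((s ^ 2 * Δ).toNNReal))) :
    ∃ bstar : ℝ, IsGreatest {b | b ∈ Set.Icc (0 : ℝ) v₀ ∧ g b = 0} bstar ∧
      bstar ∈ Set.Ioo (0 : ℝ) v₀ := by
  set μ := gaussianReal (-(s ^ 2 * Δ) / 2) ((s ^ 2 * Δ).toNNReal) with hμ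
  have hvar : (s ^ 2 * Δ).toNNReal ≠ 0 := by
    have : 0 < s ^ 2 * Δ := by positivity
    simpa using this
  have hind : ∀ b : ℝ, Set.indicator {x : ℝ | v₀ * Real.exp x < b}
      (fun x => v₀ * Real.exp x - b) = fun x => min (v₀ * Real.exp x - b) 0 := by
    intro b
    ext x
    by_cases h : v₀ * Real.exp x < b
    · rw [Set.indicator_of_mem (by exact h), min_eq_left (by linarith)]
    · rw [Set.indicator_of_notMem (by exact h), min_eq_right (by linarith)]
  have hg2 : ∀ b : ℝ, g b = (1 - p) * (v₀ - b)
      + p * ∫ x, min (v₀ * Real.exp x - b) 0 ∂μ := by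
    intro b
    rw [hg b, hind b]
  have hbound : ∀ b ∈ Set.Icc (0 : ℝ) v₀, ∀ x : ℝ, ‖min (v₀ * Real.exp x - b) 0‖ ≤ v₀ := by
    intro b hb x
    have h1 : 0 < v₀ * Real.exp x := by positivity
    rw [Real.norm_eq_abs, abs_le]
    refine ⟨le_min ?_ ?_, (min_le_right _ _).trans hv₀.le⟩
    · linarith [hb.2]
    · linarith
  have hmeas : ∀ b : ℝ, AEStronglyMeasurable (fun x => min (v₀ * Real.exp x - b) 0) μ := by
    intro b
    have : Continuous (fun x => min (v₀ * Real.exp x - b) 0) := by fun_prop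
    exact this.aestronglyMeasurable
  have hcI : ContinuousOn (fun b => ∫ x, min (v₀ * Real.exp x - b) 0 ∂μ) (Set.Icc 0 v₀) := by
    apply continuousOn_of_dominated (bound := fun _ => v₀)
    · intro b _
      exact hmeas b
    · intro b hb
      exact Filter.Eventually.of_forall (hbound b hb)
    · exact integrable_const _
    · refine Filter.Eventually.of_forall fun x => ?_
      fun_prop
  have hcont : ContinuousOn g (Set.Icc 0 v₀) := by
    have : g = fun b => (1 - p) * (v₀ - b)
      + p * ∫ x, min (v₀ * Real.exp x - b) 0 ∂μ := funext hg2
    rw [this]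
    exact ContinuousOn.add (by fun_prop) (continuousOn_const.mul hcI)
  have hg0 : 0 < g 0 := by
    have : ∀ x : ℝ, min (v₀ * Real.exp x - 0) 0 = 0 := fun x =>
      min_eq_right (by have : 0 < v₀ * Real.exp x := by positivity
                       linarith)
    rw [hg2]
    simp only [this]
    simp only [integral_zero, mul_zero, add_zero, sub_zero]
    exact mul_pos (by linarith) hv₀
  have hgv : g v₀ < 0 := by
    have hpos : 0 < ∫ x, -min (v₀ * Real.exp x - v₀) 0 ∂μ := by
      rw [integral_pos_iff_support_of_nonneg]
      · have hsub : Set.Iio (0 : ℝ) ⊆ Function.support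
            (fun x => -min (v₀ * Real.exp x - v₀) 0) := by
          intro x hx
          have hx' : Real.exp x < 1 := by simpa using hx
          have : v₀ * Real.exp x - v₀ < 0 := by nlinarith
          simp only [Function.mem_support]
          rw [min_eq_left this.le]
          linarith
        refine lt_of_lt_of_le ?_ (measure_mono hsub)
        rw [pos_iff_ne_zero]
        intro h0
        have := gaussianReal_absolutelyContinuous' (-(s ^ 2 * Δ) / 2) hvar h0
        simp at this
      · intro x
        simp
      · exact (Integrable.of_bound (hmeas v₀) v₀ (Filter.Eventually.of_forall
          (hbound v₀ ⟨hv₀.le, le_rfl⟩))).neg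
    rw [integral_neg] at hpos
    rw [hg2]
    nlinarith
  have hclosed : IsCompact (Set.Icc (0 : ℝ) v₀ ∩ g ⁻¹' {0}) :=
    isCompact_Icc.of_isClosed_subset
      (hcont.preimage_isClosed_of_isClosed isClosed_Icc isClosed_singleton)
      Set.inter_subset_left
  have hne : (Set.Icc (0 : ℝ) v₀ ∩ g ⁻¹' {0}).Nonempty := by
    obtain ⟨b, hb, hb0⟩ := intermediate_value_Icc' hv₀.le hcont ⟨hgv.le, hg0.le⟩
    exact ⟨b, hb, hb0⟩
  obtain ⟨b, hb⟩ := hclosed.exists_isGreatest hne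
  refine ⟨b, hb, ?_, ?_⟩
  · refine lt_of_le_of_ne hb.1.1.1 ?_
    rintro rfl
    exact hg0.ne' hb.1.2
  · refine lt_of_le_of_ne hb.1.1.2 ?_
    rintro rfl
    exact hgv.ne hb.1.2
end
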